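/- Let M be a complex manifold and 𝒰 = {U_0, U_1} an open covering. The cup product E^{p,q}_{BC}(𝒰) × E^{r,s}_A(𝒰) → E^{p+r,q+s}_A(𝒰) defined by (σ ⌣ ξ)_i = σ_i ∧ ξ_i for i = 0, 1, (σ ⌣ ξ)_{01}^{(1)} = (−1)^{p+q} σ_0 ∧ ξ_{01}^{(1)} + ∂σ_{01} ∧ ξ_1 − (1/2) ∂(σ_{01} ∧ ξ_1), and (σ ⌣ ξ)_{01}^{(2)} = (−1)^{p+q} σ_0 ∧ ξ_{01}^{(2)} − ∂̄σ_{01} ∧ ξ_1 + (1/2) ∂̄(σ_{01} ∧ ξ_1) sends cocycle × cocycle to cocycle, coboundary × cocycle to coboundary, and cocycle × coboundary to coboundary, and hence induces a bilinear map H^{p,q}_{BC}(𝒰) × H^{r,s}_A(𝒰) → H^{p+r,q+s}_A(𝒰), compatible with the wedge-product pairing H^{p,q}_{BC}(M) × H^{r,s}_A(M) → H^{p+r,q+s}_A(M) under the canonical isomorphisms. -/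

import Mathlib

/-!
Statement 11 (Proposition 4.2 of the paper).  Let `M` be a complex manifold and
`𝒰 = {U₀, U₁}` an open covering.  The cup product
`E^{p,q}_{BC}(𝒰) × E^{r,s}_A(𝒰) → E^{p+r,q+s}_A(𝒰)` defined by
`(σ ⌣ ξ)ᵢ = σᵢ ∧ ξᵢ` (`i = 0, 1`),
`(σ ⌣ ξ)₀₁⁽¹⁾ = (-1)^{p+q} σ₀ ∧ ξ₀₁⁽¹⁾ + ∂σ₀₁ ∧ ξ₁ - (1/2) ∂(σ₀₁ ∧ ξ₁)`,
`(σ ⌣ ξ)₀₁⁽²⁾ = (-1)^{p+q} σ₀ ∧ ξ₀₁⁽²⁾ - ∂̄σ₀₁ ∧ ξ₁ + (1/2) ∂̄(σ₀₁ ∧ ξ₁)`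
sends cocycle × cocycle to cocycle, coboundary × cocycle to coboundary, and
cocycle × coboundary to coboundary, hence induces a bilinear map
`H^{p,q}_{BC}(𝒰) × H^{r,s}_A(𝒰) → H^{p+r,q+s}_A(𝒰)`, compatible with the wedge-product
pairing `H^{p,q}_{BC}(M) × H^{r,s}_A(M) → H^{p+r,q+s}_A(M)` under the canonical
isomorphisms (i.e. on the images of the maps `ω ↦ (ω, ω, 0)` and `θ ↦ (θ, θ, 0, 0)` the
cup product is the wedge product).

The sheaves of forms are modelled abstractly by `DoubleFormSheaf`, the exterior product by
`WedgeData`.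
-/

open TopologicalSpace

universe u

section LinearHelpers

variable {A B C S : Type u} [AddCommGroup A] [Module ℂ A] [AddCommGroup B] [Module ℂ B]
  [AddCommGroup C] [Module ℂ C] [AddCommGroup S] [Module ℂ S]

/-- a linear map into a triple product -/
def lmTri (f : S →ₗ[ℂ] A) (g : S →ₗ[ℂ] B) (h : S →ₗ[ℂ] C) : S →ₗ[ℂ] A × B × C :=
  LinearMap.prod f (LinearMap.prod g h)

/-- first projection of a triple product -/
def pA : A × B × C →ₗ[ℂ] A := LinearMap.fst ℂ A (B × C)

/-- second projection of a triple product -/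
def pB : A × B × C →ₗ[ℂ] B := (LinearMap.fst ℂ B C).comp (LinearMap.snd ℂ A (B × C))

/-- third projection of a triple product -/
def pC : A × B × C →ₗ[ℂ] C := (LinearMap.snd ℂ B C).comp (LinearMap.snd ℂ A (B × C))

/-- first projection of a pair -/
def qA : A × B →ₗ[ℂ] A := LinearMap.fst ℂ A B

/-- second projection of a pair -/
def qB : A × B →ₗ[ℂ] B := LinearMap.snd ℂ A B

end LinearHelpers

/-- The cohomology of a pair of composable linear maps `f : A → B`, `g : B → C` with
`g ∘ f = 0` (in the situations where this is used):  `Ker g / Im f`. -/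
abbrev cohomOf {A B C : Type u} [AddCommGroup A] [Module ℂ A] [AddCommGroup B] [Module ℂ B]
    [AddCommGroup C] [Module ℂ C] (f : A →ₗ[ℂ] B) (g : B →ₗ[ℂ] C) : Type u :=
  ↥(LinearMap.ker g) ⧸ (Submodule.comap (LinearMap.ker g).subtype (LinearMap.range f))

/-- The cohomology class of a cocycle. -/
def cohomMk {A B C : Type u} [AddCommGroup A] [Module ℂ A] [AddCommGroup B] [Module ℂ B]
    [AddCommGroup C] [Module ℂ C] (f : A →ₗ[ℂ] B) (g : B →ₗ[ℂ] C) (b : B) (hb : g b = 0) :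
    cohomOf f g :=
  Submodule.Quotient.mk ⟨b, LinearMap.mem_ker.mpr hb⟩

/-- The sheaves `E^{p,q}` of `C^∞` differential forms of type `(p,q)` on (the underlying
topological space of) a complex manifold, encoded abstractly: a presheaf of `ℂ`-modules
`E p q U` with the differentials `∂` (`del`) and `∂̄` (`dbar`), satisfying `∂² = ∂̄² = 0`,
`∂∂̄ + ∂̄∂ = 0`, compatibility with restrictions, the sheaf gluing condition for pairs of
open sets, and the softness property coming from `C^∞` partitions of unity (`pou`). -/
structure DoubleFormSheaf (X : Type u) [TopologicalSpace X] : Type (u + 1) where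
  /-- the `ℂ`-module of `(p,q)`-forms on an open set `U` -/
  E : ℤ → ℤ → Opens X → ModuleCat.{u} ℂ
  /-- restriction of forms -/
  res : ∀ (p q : ℤ) ⦃U V : Opens X⦄, U ≤ V → ((E p q V) →ₗ[ℂ] (E p q U))
  res_refl : ∀ (p q : ℤ) (U : Opens X) (x : E p q U), res p q (le_refl U) x = x
  res_res : ∀ (p q : ℤ) ⦃U V W : Opens X⦄ (hUV : U ≤ V) (hVW : V ≤ W) (x : E p q W),
      res p q hUV (res p q hVW x) = res p q (hUV.trans hVW) x
  /-- the differential `∂` -/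
  del : ∀ (p q : ℤ) (U : Opens X), (E p q U) →ₗ[ℂ] (E (p + 1) q U)
  /-- the differential `∂̄` -/
  dbar : ∀ (p q : ℤ) (U : Opens X), (E p q U) →ₗ[ℂ] (E p (q + 1) U)
  del_del : ∀ (p q : ℤ) (U : Opens X) (x : E p q U), del (p + 1) q U (del p q U x) = 0
  dbar_dbar : ∀ (p q : ℤ) (U : Opens X) (x : E p q U), dbar p (q + 1) U (dbar p q U x) = 0
  del_dbar : ∀ (p q : ℤ) (U : Opens X) (x : E p q U),
      del p (q + 1) U (dbar p q U x) + dbar (p + 1) q U (del p q U x) = 0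
  res_del : ∀ (p q : ℤ) ⦃U V : Opens X⦄ (h : U ≤ V) (x : E p q V),
      del p q U (res p q h x) = res (p + 1) q h (del p q V x)
  res_dbar : ∀ (p q : ℤ) ⦃U V : Opens X⦄ (h : U ≤ V) (x : E p q V),
      dbar p q U (res p q h x) = res p (q + 1) h (dbar p q V x)
  /-- sheaf condition: forms agreeing on the overlap glue -/
  glue : ∀ (p q : ℤ) ⦃U V : Opens X⦄ (a : E p q U) (b : E p q V),
      res p q inf_le_left a = res p q inf_le_right b →
      ∃! c : E p q (U ⊔ V), res p q le_sup_left c = a ∧ res p q le_sup_right c = b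
  /-- softness coming from `C^∞` partitions of unity subordinate to a two-set open cover:
  "multiplication by `ρ₁` (resp. `ρ₀`) followed by extension by zero" operators. -/
  pou : ∀ ⦃U V : Opens X⦄, U ⊔ V = ⊤ →
      ∃ (z₀ : ∀ p q : ℤ, ((E p q (U ⊓ V)) →ₗ[ℂ] (E p q U)))
        (z₁ : ∀ p q : ℤ, ((E p q (U ⊓ V)) →ₗ[ℂ] (E p q V))),
        ∀ (p q : ℤ) (x : E p q (U ⊓ V)),
          res p q inf_le_left (z₀ p q x) + res p q inf_le_right (z₁ p q x) = x

namespace DoubleFormSheaf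

variable {X : Type u} [TopologicalSpace X] (F : DoubleFormSheaf X)

/-- identification of the modules of forms in equal bidegrees -/
def cast (U : Opens X) :
    ∀ {p q p' q' : ℤ}, p = p' → q = q' → ((F.E p q U) →ₗ[ℂ] (F.E p' q' U))
  | _, _, _, _, rfl, rfl => LinearMap.id

section Cech

variable (U₀ U₁ : Opens X)

/-- Čech–Bott–Chern cochains `E^{p,q}_{BC}(𝒰) = E^{p,q}(U₀) ⊕ E^{p,q}(U₁) ⊕ E^{p-1,q-1}(U₀₁)` -/
abbrev TBC (p q : ℤ) : Type u :=
  ↥(F.E p q U₀) × ↥(F.E p q U₁) × ↥(F.E (p - 1) (q - 1) (U₀ ⊓ U₁))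

/-- Čech–Aeppli cochains
`E^{p,q}_{A}(𝒰) = E^{p,q}(U₀) ⊕ E^{p,q}(U₁) ⊕ E^{(p-1,q-1)+1}(U₀₁)`,
`E^{(p-1,q-1)+1} = E^{p,q-1} ⊕ E^{p-1,q}` -/
abbrev TA (p q : ℤ) : Type u :=
  ↥(F.E p q U₀) × ↥(F.E p q U₁) ×
    (↥(F.E p (q - 1) (U₀ ⊓ U₁)) × ↥(F.E (p - 1) q (U₀ ⊓ U₁)))

/-- Čech cochains of the third type
`E^{(p,q)+1}(𝒰) = E^{(p,q)+1}(U₀) ⊕ E^{(p,q)+1}(U₁) ⊕ E^{p,q}(U₀₁)`,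
`E^{(p,q)+1} = E^{p+1,q} ⊕ E^{p,q+1}` -/
abbrev TT (p q : ℤ) : Type u :=
  (↥(F.E (p + 1) q U₀) × ↥(F.E p (q + 1) U₀)) ×
    (↥(F.E (p + 1) q U₁) × ↥(F.E p (q + 1) U₁)) × ↥(F.E p q (U₀ ⊓ U₁))

/-- Čech–Dolbeault cochains `E^{p,q}(𝒰) = E^{p,q}(U₀) ⊕ E^{p,q}(U₁) ⊕ E^{p,q-1}(U₀₁)` -/
abbrev TD (p q : ℤ) : Type u :=
  ↥(F.E p q U₀) × ↥(F.E p q U₁) × ↥(F.E p (q - 1) (U₀ ⊓ U₁))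

/-- relative Čech–Bott–Chern cochains `E^{p,q}_{BC}(𝒰, U₀) = E^{p,q}(U₁) ⊕ E^{p-1,q-1}(U₀₁)` -/
abbrev RBC (p q : ℤ) : Type u :=
  ↥(F.E p q U₁) × ↥(F.E (p - 1) (q - 1) (U₀ ⊓ U₁))

/-- relative Čech–Aeppli cochains `E^{p,q}_{A}(𝒰, U₀) = E^{p,q}(U₁) ⊕ E^{(p-1,q-1)+1}(U₀₁)` -/
abbrev RA (p q : ℤ) : Type u :=
  ↥(F.E p q U₁) × (↥(F.E p (q - 1) (U₀ ⊓ U₁)) × ↥(F.E (p - 1) q (U₀ ⊓ U₁)))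

/-- relative Čech cochains of the third type `E^{(p,q)+1}(𝒰, U₀) = E^{(p,q)+1}(U₁) ⊕ E^{p,q}(U₀₁)` -/
abbrev RT (p q : ℤ) : Type u :=
  (↥(F.E (p + 1) q U₁) × ↥(F.E p (q + 1) U₁)) × ↥(F.E p q (U₀ ⊓ U₁))

/-- relative Čech–Dolbeault cochains `E^{p,q}(𝒰, U₀) = E^{p,q}(U₁) ⊕ E^{p,q-1}(U₀₁)` -/
abbrev RD (p q : ℤ) : Type u :=
  ↥(F.E p q U₁) × ↥(F.E p (q - 1) (U₀ ⊓ U₁))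

/-- the Čech differential `E^{p,q}_{BC}(𝒰) → E^{(p,q)+1}(𝒰)`,
`σ ↦ ((∂σ₀, ∂̄σ₀), (∂σ₁, ∂̄σ₁), σ₁ - σ₀ - ∂̄∂σ₀₁)` (i.e. `σ ↦ (dσ₀, dσ₁, σ₁ - σ₀ - ∂̄∂σ₀₁)`) -/
def DtoTT (p q : ℤ) : TBC F U₀ U₁ p q →ₗ[ℂ] TT F U₀ U₁ p q :=
  lmTri
    (LinearMap.prod ((F.del p q U₀).comp pA) ((F.dbar p q U₀).comp pA))
    (LinearMap.prod ((F.del p q U₁).comp pB) ((F.dbar p q U₁).comp pB))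
    (((F.res p q inf_le_right).comp pB - (F.res p q inf_le_left).comp pA) -
      ((F.cast (U₀ ⊓ U₁) (show p - 1 + 1 = p by ring) (show q - 1 + 1 = q by ring)).comp
        ((F.dbar (p - 1 + 1) (q - 1) (U₀ ⊓ U₁)).comp
          ((F.del (p - 1) (q - 1) (U₀ ⊓ U₁)).comp pC))))

/-- the Čech differential `E^{(p,q)+1}(𝒰) → E^{p+1,q+1}_{A?}(𝒰)`; more precisely the
differential `E^{(p,q)+1}(𝒰) → E^{p+1,q+1}(𝒰)`-component of the mixed complex, landing in
the Aeppli-type cochains `E^{p+1,q+1}_{A}(𝒰)`: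
`((α₀,β₀), (α₁,β₁), γ) ↦ (∂̄α₀ + ∂β₀, ∂̄α₁ + ∂β₁, (α₁ - α₀ - ∂γ, β₁ - β₀ - ∂̄γ))` -/
def DtoTA (p q : ℤ) : TT F U₀ U₁ p q →ₗ[ℂ] TA F U₀ U₁ (p + 1) (q + 1) :=
  lmTri
    (((F.dbar (p + 1) q U₀).comp (qA.comp pA)) + ((F.del p (q + 1) U₀).comp (qB.comp pA)))
    (((F.dbar (p + 1) q U₁).comp (qA.comp pB)) + ((F.del p (q + 1) U₁).comp (qB.comp pB)))
    (LinearMap.prod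
      ((F.cast (U₀ ⊓ U₁) rfl (show q = q + 1 - 1 by ring)).comp
        (((F.res (p + 1) q inf_le_right).comp (qA.comp pB) -
            (F.res (p + 1) q inf_le_left).comp (qA.comp pA)) -
          ((F.del p q (U₀ ⊓ U₁)).comp pC)))
      ((F.cast (U₀ ⊓ U₁) (show p = p + 1 - 1 by ring) rfl).comp
        (((F.res p (q + 1) inf_le_right).comp (qB.comp pB) -
            (F.res p (q + 1) inf_le_left).comp (qB.comp pA)) -
          ((F.dbar p q (U₀ ⊓ U₁)).comp pC))))

/-- the Čech differential `E^{p,q}_{A}(𝒰) → E^{p+1,q+1}_{BC}(𝒰)`: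
`(ξ₀, ξ₁, (η₁, η₂)) ↦ (∂̄∂ξ₀, ∂̄∂ξ₁, ξ₁ - ξ₀ - ∂̄η₁ - ∂η₂)` -/
def DtoTBC (p q : ℤ) : TA F U₀ U₁ p q →ₗ[ℂ] TBC F U₀ U₁ (p + 1) (q + 1) :=
  lmTri
    ((F.dbar (p + 1) q U₀).comp ((F.del p q U₀).comp pA))
    ((F.dbar (p + 1) q U₁).comp ((F.del p q U₁).comp pB))
    ((F.cast (U₀ ⊓ U₁) (show p = p + 1 - 1 by ring) (show q = q + 1 - 1 by ring)).comp
      ((((F.res p q inf_le_right).comp pB - (F.res p q inf_le_left).comp pA) -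
          ((F.cast (U₀ ⊓ U₁) rfl (show q - 1 + 1 = q by ring)).comp
            ((F.dbar p (q - 1) (U₀ ⊓ U₁)).comp (qA.comp pC)))) -
        ((F.cast (U₀ ⊓ U₁) (show p - 1 + 1 = p by ring) rfl).comp
          ((F.del (p - 1) q (U₀ ⊓ U₁)).comp (qB.comp pC)))))

/-- the Čech–Dolbeault differential `∂̄ϑ σ = (∂̄σ₀, ∂̄σ₁, σ₁ - σ₀ - ∂̄σ₀₁)` -/
def DD (p q : ℤ) : TD F U₀ U₁ p q →ₗ[ℂ] TD F U₀ U₁ p (q + 1) :=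
  lmTri
    ((F.dbar p q U₀).comp pA)
    ((F.dbar p q U₁).comp pB)
    (((F.cast (U₀ ⊓ U₁) rfl (show q = q + 1 - 1 by ring)).comp
        ((F.res p q inf_le_right).comp pB - (F.res p q inf_le_left).comp pA)) -
      ((F.cast (U₀ ⊓ U₁) rfl (show q - 1 + 1 = q + 1 - 1 by ring)).comp
        ((F.dbar p (q - 1) (U₀ ⊓ U₁)).comp pC)))

/-- the relative Čech differential `E^{p,q}_{BC}(𝒰,U₀) → E^{(p,q)+1}(𝒰,U₀)` -/
def RtoTT (p q : ℤ) : RBC F U₀ U₁ p q →ₗ[ℂ] RT F U₀ U₁ p q :=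
  LinearMap.prod
    (LinearMap.prod ((F.del p q U₁).comp qA) ((F.dbar p q U₁).comp qA))
    (((F.res p q inf_le_right).comp qA) -
      ((F.cast (U₀ ⊓ U₁) (show p - 1 + 1 = p by ring) (show q - 1 + 1 = q by ring)).comp
        ((F.dbar (p - 1 + 1) (q - 1) (U₀ ⊓ U₁)).comp
          ((F.del (p - 1) (q - 1) (U₀ ⊓ U₁)).comp qB))))

/-- the relative Čech differential `E^{(p,q)+1}(𝒰,U₀) → E^{p+1,q+1}_{A}(𝒰,U₀)` -/
def RtoTA (p q : ℤ) : RT F U₀ U₁ p q →ₗ[ℂ] RA F U₀ U₁ (p + 1) (q + 1) :=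
  LinearMap.prod
    (((F.dbar (p + 1) q U₁).comp (qA.comp qA)) + ((F.del p (q + 1) U₁).comp (qB.comp qA)))
    (LinearMap.prod
      ((F.cast (U₀ ⊓ U₁) rfl (show q = q + 1 - 1 by ring)).comp
        (((F.res (p + 1) q inf_le_right).comp (qA.comp qA)) -
          ((F.del p q (U₀ ⊓ U₁)).comp qB)))
      ((F.cast (U₀ ⊓ U₁) (show p = p + 1 - 1 by ring) rfl).comp
        (((F.res p (q + 1) inf_le_right).comp (qB.comp qA)) -
          ((F.dbar p q (U₀ ⊓ U₁)).comp qB))))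

/-- the relative Čech differential `E^{p,q}_{A}(𝒰,U₀) → E^{p+1,q+1}_{BC}(𝒰,U₀)` -/
def RtoTBC (p q : ℤ) : RA F U₀ U₁ p q →ₗ[ℂ] RBC F U₀ U₁ (p + 1) (q + 1) :=
  LinearMap.prod
    ((F.dbar (p + 1) q U₁).comp ((F.del p q U₁).comp qA))
    ((F.cast (U₀ ⊓ U₁) (show p = p + 1 - 1 by ring) (show q = q + 1 - 1 by ring)).comp
      ((((F.res p q inf_le_right).comp qA) -
          ((F.cast (U₀ ⊓ U₁) rfl (show q - 1 + 1 = q by ring)).comp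
            ((F.dbar p (q - 1) (U₀ ⊓ U₁)).comp (qA.comp qB)))) -
        ((F.cast (U₀ ⊓ U₁) (show p - 1 + 1 = p by ring) rfl).comp
          ((F.del (p - 1) q (U₀ ⊓ U₁)).comp (qB.comp qB)))))

/-- the relative Čech–Dolbeault differential -/
def DrD (p q : ℤ) : RD F U₀ U₁ p q →ₗ[ℂ] RD F U₀ U₁ p (q + 1) :=
  LinearMap.prod
    ((F.dbar p q U₁).comp qA)
    (((F.cast (U₀ ⊓ U₁) rfl (show q = q + 1 - 1 by ring)).comp
        ((F.res p q inf_le_right).comp qA)) -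
      ((F.cast (U₀ ⊓ U₁) rfl (show q - 1 + 1 = q + 1 - 1 by ring)).comp
        ((F.dbar p (q - 1) (U₀ ⊓ U₁)).comp qB)))

/-- identification of Čech–Bott–Chern cochains in equal bidegrees -/
def castTBC {p q p' q' : ℤ} (hp : p = p') (hq : q = q') :
    TBC F U₀ U₁ p q →ₗ[ℂ] TBC F U₀ U₁ p' q' :=
  lmTri ((F.cast U₀ hp hq).comp pA) ((F.cast U₁ hp hq).comp pB)
    ((F.cast _ (by rw [hp]) (by rw [hq])).comp pC)

/-- identification of Čech–Aeppli cochains in equal bidegrees -/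
def castTA {p q p' q' : ℤ} (hp : p = p') (hq : q = q') :
    TA F U₀ U₁ p q →ₗ[ℂ] TA F U₀ U₁ p' q' :=
  lmTri ((F.cast U₀ hp hq).comp pA) ((F.cast U₁ hp hq).comp pB)
    (LinearMap.prod ((F.cast _ hp (by rw [hq])).comp (qA.comp pC))
      ((F.cast _ (by rw [hp]) hq).comp (qB.comp pC)))

/-- identification of Čech–Dolbeault cochains in equal bidegrees -/
def castTD {p q p' q' : ℤ} (hp : p = p') (hq : q = q') :
    TD F U₀ U₁ p q →ₗ[ℂ] TD F U₀ U₁ p' q' :=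
  lmTri ((F.cast U₀ hp hq).comp pA) ((F.cast U₁ hp hq).comp pB)
    ((F.cast _ hp (by rw [hq])).comp pC)

/-- identification of relative Čech–Bott–Chern cochains in equal bidegrees -/
def castRBC {p q p' q' : ℤ} (hp : p = p') (hq : q = q') :
    RBC F U₀ U₁ p q →ₗ[ℂ] RBC F U₀ U₁ p' q' :=
  LinearMap.prod ((F.cast U₁ hp hq).comp qA)
    ((F.cast _ (by rw [hp]) (by rw [hq])).comp qB)

/-- identification of relative Čech–Aeppli cochains in equal bidegrees -/
def castRA {p q p' q' : ℤ} (hp : p = p') (hq : q = q') :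
    RA F U₀ U₁ p q →ₗ[ℂ] RA F U₀ U₁ p' q' :=
  LinearMap.prod ((F.cast U₁ hp hq).comp qA)
    (LinearMap.prod ((F.cast _ hp (by rw [hq])).comp (qA.comp qB))
      ((F.cast _ (by rw [hp]) hq).comp (qB.comp qB)))

/-- identification of relative Čech–Dolbeault cochains in equal bidegrees -/
def castRD {p q p' q' : ℤ} (hp : p = p') (hq : q = q') :
    RD F U₀ U₁ p q →ₗ[ℂ] RD F U₀ U₁ p' q' :=
  LinearMap.prod ((F.cast U₁ hp hq).comp qA)
    ((F.cast _ hp (by rw [hq])).comp qB)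

/-- the Čech–Bott–Chern cohomology `H^{p,q}_{BC}(𝒰)` -/
abbrev HBCcech (p q : ℤ) : Type u :=
  cohomOf
    ((castTBC F U₀ U₁ (show p - 1 + 1 = p by ring) (show q - 1 + 1 = q by ring)).comp
      (DtoTBC F U₀ U₁ (p - 1) (q - 1)))
    (DtoTT F U₀ U₁ p q)

/-- the Čech–Aeppli cohomology `H^{p,q}_{A}(𝒰)` -/
abbrev HAcech (p q : ℤ) : Type u :=
  cohomOf
    ((castTA F U₀ U₁ (show p - 1 + 1 = p by ring) (show q - 1 + 1 = q by ring)).comp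
      (DtoTA F U₀ U₁ (p - 1) (q - 1)))
    (DtoTBC F U₀ U₁ p q)

/-- the Čech cohomology of the third type `H^{(p,q)+1}(𝒰)` -/
abbrev HTcech (p q : ℤ) : Type u :=
  cohomOf (DtoTT F U₀ U₁ p q) (DtoTA F U₀ U₁ p q)

/-- the Čech–Dolbeault cohomology `H^{p,q}_{∂̄ϑ}(𝒰)` -/
abbrev HDcech (p q : ℤ) : Type u :=
  cohomOf ((castTD F U₀ U₁ rfl (show q - 1 + 1 = q by ring)).comp (DD F U₀ U₁ p (q - 1)))
    (DD F U₀ U₁ p q)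

/-- the relative Bott–Chern cohomology `H^{p,q}_{BC}(𝒰, U₀)` -/
abbrev HBCrel (p q : ℤ) : Type u :=
  cohomOf
    ((castRBC F U₀ U₁ (show p - 1 + 1 = p by ring) (show q - 1 + 1 = q by ring)).comp
      (RtoTBC F U₀ U₁ (p - 1) (q - 1)))
    (RtoTT F U₀ U₁ p q)

/-- the relative Aeppli cohomology `H^{p,q}_{A}(𝒰, U₀)` -/
abbrev HArel (p q : ℤ) : Type u :=
  cohomOf
    ((castRA F U₀ U₁ (show p - 1 + 1 = p by ring) (show q - 1 + 1 = q by ring)).comp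
      (RtoTA F U₀ U₁ (p - 1) (q - 1)))
    (RtoTBC F U₀ U₁ p q)

/-- the relative cohomology of the third type `H^{(p,q)+1}(𝒰, U₀)` -/
abbrev HTrel (p q : ℤ) : Type u :=
  cohomOf (RtoTT F U₀ U₁ p q) (RtoTA F U₀ U₁ p q)

/-- the relative Dolbeault cohomology `H^{p,q}_{∂̄ϑ}(𝒰, U₀)` -/
abbrev HDrel (p q : ℤ) : Type u :=
  cohomOf ((castRD F U₀ U₁ rfl (show q - 1 + 1 = q by ring)).comp (DrD F U₀ U₁ p (q - 1)))
    (DrD F U₀ U₁ p q)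

end Cech

section OpenSet

variable (W : Opens X)

/-- the differential `∂̄ + ∂ : E^{(p-1,q-1)+1}(W) → E^{p,q}(W)`, `(η₁, η₂) ↦ ∂̄η₁ + ∂η₂` -/
def plusW (p q : ℤ) :
    (↥(F.E p (q - 1) W) × ↥(F.E (p - 1) q W)) →ₗ[ℂ] ↥(F.E p q W) :=
  ((F.cast W rfl (show q - 1 + 1 = q by ring)).comp ((F.dbar p (q - 1) W).comp qA)) +
    ((F.cast W (show p - 1 + 1 = p by ring) rfl).comp ((F.del (p - 1) q W).comp qB))

/-- the differential `∂̄∂ : E^{p,q}(W) → E^{p+1,q+1}(W)` -/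
def ddbarW (p q : ℤ) : ↥(F.E p q W) →ₗ[ℂ] ↥(F.E (p + 1) (q + 1) W) :=
  (F.dbar (p + 1) q W).comp (F.del p q W)

/-- the differential `d : E^{p,q}(W) → E^{(p,q)+1}(W)`, `ω ↦ (∂ω, ∂̄ω)` -/
def dfullW (p q : ℤ) :
    ↥(F.E p q W) →ₗ[ℂ] (↥(F.E (p + 1) q W) × ↥(F.E p (q + 1) W)) :=
  LinearMap.prod (F.del p q W) (F.dbar p q W)

/-- the differential `∂̄ + ∂ : E^{(p,q)+1}(W) → E^{p+1,q+1}(W)`, `(α, β) ↦ ∂̄α + ∂β` -/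
def plusTW (p q : ℤ) :
    (↥(F.E (p + 1) q W) × ↥(F.E p (q + 1) W)) →ₗ[ℂ] ↥(F.E (p + 1) (q + 1) W) :=
  ((F.dbar (p + 1) q W).comp qA) + ((F.del p (q + 1) W).comp qB)

/-- the Bott–Chern cohomology `H^{p,q}_{BC}(W)` of an open set `W` -/
abbrev HBCopen (p q : ℤ) : Type u :=
  cohomOf
    ((F.cast W (show p - 1 + 1 = p by ring) (show q - 1 + 1 = q by ring)).comp
      (ddbarW F W (p - 1) (q - 1)))
    (dfullW F W p q)

/-- the Aeppli cohomology `H^{p,q}_{A}(W)` of an open set `W` -/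
abbrev HAopen (p q : ℤ) : Type u :=
  cohomOf (plusW F W p q) (ddbarW F W p q)

/-- the cohomology of the third type `H^{(p,q)+1}(W)` of an open set `W` -/
abbrev HTopen (p q : ℤ) : Type u :=
  cohomOf (dfullW F W p q) (plusTW F W p q)

/-- the Dolbeault cohomology `H^{p,q}_{∂̄}(W)` of an open set `W` -/
abbrev HDopen (p q : ℤ) : Type u :=
  cohomOf ((F.cast W rfl (show q - 1 + 1 = q by ring)).comp (F.dbar p (q - 1) W))
    (F.dbar p q W)

end OpenSet

section Tilde

variable (U₀ U₁ : Opens X)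

/-- the map `ω ↦ (ω|_{U₀}, ω|_{U₁}, 0)` into Čech–Bott–Chern cochains -/
def tBC (p q : ℤ) : ↥(F.E p q ⊤) →ₗ[ℂ] TBC F U₀ U₁ p q :=
  lmTri (F.res p q le_top) (F.res p q le_top) 0

/-- the map `ω ↦ (ω|_{U₀}, ω|_{U₁}, 0, 0)` into Čech–Aeppli cochains -/
def tA (p q : ℤ) : ↥(F.E p q ⊤) →ₗ[ℂ] TA F U₀ U₁ p q :=
  lmTri (F.res p q le_top) (F.res p q le_top) 0

/-- the map `ω ↦ (ω|_{U₀}, ω|_{U₁}, 0)` into Čech–Dolbeault cochains -/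
def tD (p q : ℤ) : ↥(F.E p q ⊤) →ₗ[ℂ] TD F U₀ U₁ p q :=
  lmTri (F.res p q le_top) (F.res p q le_top) 0

end Tilde

end DoubleFormSheaf

/-- The exterior product on the sheaves of `(p,q)`-forms, with its basic properties
(bilinearity, compatibility with restriction, and the Leibniz rules for `∂` and `∂̄`). -/
structure WedgeData {X : Type u} [TopologicalSpace X] (F : DoubleFormSheaf X) : Type u where
  /-- the exterior product `E^{p,q}(U) × E^{r,s}(U) → E^{p+r,q+s}(U)` -/
  wedge : ∀ (p q r s : ℤ) (U : Opens X),
      (F.E p q U) →ₗ[ℂ] ((F.E r s U) →ₗ[ℂ] (F.E (p + r) (q + s) U))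
  wedge_res : ∀ (p q r s : ℤ) ⦃U V : Opens X⦄ (h : U ≤ V) (x : F.E p q V) (y : F.E r s V),
      F.res (p + r) (q + s) h (wedge p q r s V x y)
        = wedge p q r s U (F.res p q h x) (F.res r s h y)
  wedge_del : ∀ (p q r s : ℤ) (U : Opens X) (x : F.E p q U) (y : F.E r s U),
      F.del (p + r) (q + s) U (wedge p q r s U x y)
        = F.cast U (show p + 1 + r = p + r + 1 by ring) rfl
            (wedge (p + 1) q r s U (F.del p q U x) y)
          + ((-1 : ℂ) ^ (p + q)) •
              F.cast U (show p + (r + 1) = p + r + 1 by ring) rfl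
                (wedge p q (r + 1) s U x (F.del r s U y))
  wedge_dbar : ∀ (p q r s : ℤ) (U : Opens X) (x : F.E p q U) (y : F.E r s U),
      F.dbar (p + r) (q + s) U (wedge p q r s U x y)
        = F.cast U rfl (show q + 1 + s = q + s + 1 by ring)
            (wedge p (q + 1) r s U (F.dbar p q U x) y)
          + ((-1 : ℂ) ^ (p + q)) •
              F.cast U rfl (show q + (s + 1) = q + s + 1 by ring)
                (wedge p q r (s + 1) U x (F.dbar r s U y))


open DoubleFormSheaf

/-- Two anticommuting differentials `d`, `b` on a module carrying a bilinear product. -/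
structure BiDifferential (D : Type u) [AddCommGroup D] [Module ℂ D] where
  d : D →ₗ[ℂ] D
  b : D →ₗ[ℂ] D
  mul : D →ₗ[ℂ] D →ₗ[ℂ] D
  d_d : ∀ x, d (d x) = 0
  b_b : ∀ x, b (b x) = 0
  d_b : ∀ x, d (b x) = -b (d x)

namespace BiDifferential

variable {D : Type u} [AddCommGroup D] [Module ℂ D] (A : BiDifferential D)

/-- Both differentials satisfy the Leibniz rule with sign `e` for left multiplication by `x`. -/
structure Leibniz (e : ℂ) (x : D) : Prop where
  d_mul : ∀ y, A.d (A.mul x y) = A.mul (A.d x) y + e • A.mul x (A.d y)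
  b_mul : ∀ y, A.b (A.mul x y) = A.mul (A.b x) y + e • A.mul x (A.b y)

noncomputable section

/-- The component `∂x ∧ y - (1/2) ∂(x ∧ y)` of the cup product. -/
def cupD (x y : D) : D := A.mul (A.d x) y - (2⁻¹ : ℂ) • A.d (A.mul x y)

/-- The component `-∂̄x ∧ y + (1/2) ∂̄(x ∧ y)` of the cup product. -/
def cupB (x y : D) : D := -A.mul (A.b x) y + (2⁻¹ : ℂ) • A.b (A.mul x y)

end

variable {A} {e : ℂ}

theorem b_cupD_add_d_cupB (he : e = 1 ∨ e = -1) {x y : D} (hx : A.Leibniz e x)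
    (hdx : A.Leibniz (-e) (A.d x)) (hbx : A.Leibniz (-e) (A.b x)) (hy : A.b (A.d y) = 0) :
    A.b (A.cupD x y) + A.d (A.cupB x y) = A.mul (A.b (A.d x)) y := by
  rcases he with rfl | rfl <;>
  simp only [cupD, cupB, map_sub, map_add, map_smul, map_neg, hx.d_mul, hx.b_mul, hdx.b_mul,
    A.d_b, hbx.d_mul, hy, LinearMap.neg_apply, map_zero] <;> module

theorem b_d_mul_of_closed {x y : D} (hx : A.Leibniz e x) (hdx : A.d x = 0) (hbx : A.b x = 0)
    (hy : A.b (A.d y) = 0) : A.b (A.d (A.mul x y)) = 0 := by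
  simp [hx.d_mul, hx.b_mul, hdx, hbx, hy]

theorem mul_coboundary_of_closed (he : e = 1 ∨ e = -1) {x v w : D} (hx : A.Leibniz e x)
    (hdx : A.d x = 0) (hbx : A.b x = 0) :
    A.mul x (A.b v + A.d w) = e • A.b (A.mul x v) + e • A.d (A.mul x w) := by
  rcases he with rfl | rfl <;> simp [hx.d_mul, hx.b_mul, hdx, hbx]

theorem mul_sub_mul_eq (he : e = 1 ∨ e = -1) {x₀ x₁ t y₀ y₁ v w : D}
    (hx : A.Leibniz e x₀) (hdx : A.d x₀ = 0) (hbx : A.b x₀ = 0)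
    (ht : A.Leibniz e t) (hdt : A.Leibniz (-e) (A.d t)) (hbt : A.Leibniz (-e) (A.b t))
    (hxx : x₁ = x₀ + A.b (A.d t)) (hyy : y₀ = y₁ - A.b v - A.d w) (hy : A.b (A.d y₁) = 0) :
    A.mul x₁ y₁ - A.mul x₀ y₀ =
      A.b (e • A.mul x₀ v + A.cupD t y₁) + A.d (e • A.mul x₀ w + A.cupB t y₁) := by
  have h := b_cupD_add_d_cupB he ht hdt hbt hy
  rw [map_add, map_add, add_add_add_comm, h, hxx, hyy]
  rcases he with rfl | rfl <;>
  simp only [map_sub, map_add, map_smul, LinearMap.add_apply, hx.d_mul, hx.b_mul, hdx, hbx,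
    map_zero, LinearMap.zero_apply] <;> module

theorem cupD_coboundary_left (he : e = 1 ∨ e = -1) {τ₀ τ₁ t u s x₀ y₀ y₁ v w : D}
    (hx₀ : x₀ = A.b (A.d τ₀)) (hs : s = τ₁ - τ₀ - A.b t - A.d u)
    (hyy : y₀ = y₁ - A.b v - A.d w) (hy : A.b (A.d y₁) = 0)
    (hτ : A.Leibniz e τ₀) (hdτ : A.Leibniz (-e) (A.d τ₀))
    (ht : A.Leibniz (-e) t) (hbt : A.Leibniz e (A.b t)) (hdu : A.Leibniz e (A.d u)) :
    e • A.mul x₀ v + A.cupD s y₁ = A.cupD τ₁ y₁ - A.cupD τ₀ y₀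
      - A.d ((2⁻¹ : ℂ) • (A.mul τ₀ (A.d w) - A.mul τ₀ (A.b v) + A.mul (A.b t) y₁
          - A.mul (A.d u) y₁))
      - A.b (-e • (A.mul (A.d τ₀) v + A.mul t (A.d y₁))) := by
  subst hx₀ hs hyy
  rcases he with rfl | rfl <;>
  simp only [cupD, map_sub, map_add, map_smul, map_neg, LinearMap.sub_apply,
    LinearMap.neg_apply, hτ.d_mul, hdτ.b_mul, ht.b_mul, hbt.d_mul, hdu.d_mul,
    A.d_d, A.d_b, hy, map_zero, LinearMap.zero_apply] <;> module

theorem cupB_coboundary_left (he : e = 1 ∨ e = -1) {τ₀ τ₁ t u s x₀ y₀ y₁ v w : D}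
    (hx₀ : x₀ = A.b (A.d τ₀)) (hs : s = τ₁ - τ₀ - A.b t - A.d u)
    (hyy : y₀ = y₁ - A.b v - A.d w) (hy : A.b (A.d y₁) = 0)
    (hτ : A.Leibniz e τ₀) (hbτ : A.Leibniz (-e) (A.b τ₀))
    (hu : A.Leibniz (-e) u) (hbt : A.Leibniz e (A.b t)) (hdu : A.Leibniz e (A.d u)) :
    e • A.mul x₀ w + A.cupB s y₁ = A.cupB τ₁ y₁ - A.cupB τ₀ y₀
      - A.b ((2⁻¹ : ℂ) • (A.mul τ₀ (A.d w) - A.mul τ₀ (A.b v) + A.mul (A.b t) y₁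
          - A.mul (A.d u) y₁))
      - A.d (e • (A.mul (A.b τ₀) w + A.mul u (A.b y₁))) := by
  subst hx₀ hs hyy
  rcases he with rfl | rfl <;>
  simp only [cupB, map_sub, map_add, map_smul, map_neg, LinearMap.sub_apply,
    LinearMap.neg_apply, hτ.b_mul, hbτ.d_mul, hu.d_mul, hbt.b_mul, hdu.b_mul,
    A.b_b, A.d_b, hy, map_zero, LinearMap.zero_apply, neg_zero] <;> module

theorem cupD_coboundary_right (he : e = 1 ∨ e = -1) {x₀ x₁ s y₁ v₀ v₁ w₁ v z : D}
    (hx : A.Leibniz e x₀) (hdx : A.d x₀ = 0)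
    (hs : A.Leibniz e s) (hds : A.Leibniz (-e) (A.d s))
    (hxx : x₁ = x₀ + A.b (A.d s)) (hy : y₁ = A.b v₁ + A.d w₁) (hv : v = v₁ - v₀ - A.d z) :
    e • A.mul x₀ v + A.cupD s y₁ = e • A.mul x₁ v₁ - e • A.mul x₀ v₀
      - A.d ((2⁻¹ : ℂ) • (A.mul s (A.b v₁) - A.mul s (A.d w₁)) + A.mul x₀ z)
      - A.b (e • A.mul (A.d s) v₁) := by
  subst hxx hy hv
  rcases he with rfl | rfl <;>
  simp only [cupD, map_sub, map_add, map_smul, map_neg, LinearMap.add_apply,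
    hs.d_mul, hds.b_mul, hx.d_mul, hdx,
    A.d_d, A.d_b, map_zero, LinearMap.zero_apply] <;> module

theorem cupB_coboundary_right (he : e = 1 ∨ e = -1) {x₀ x₁ s y₁ v₁ w₀ w₁ w z : D}
    (hx : A.Leibniz e x₀) (hbx : A.b x₀ = 0)
    (hs : A.Leibniz e s) (hbs : A.Leibniz (-e) (A.b s))
    (hxx : x₁ = x₀ + A.b (A.d s)) (hy : y₁ = A.b v₁ + A.d w₁) (hw : w = w₁ - w₀ - A.b z) :
    e • A.mul x₀ w + A.cupB s y₁ = e • A.mul x₁ w₁ - e • A.mul x₀ w₀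
      - A.b ((2⁻¹ : ℂ) • (A.mul s (A.b v₁) - A.mul s (A.d w₁)) + A.mul x₀ z)
      - A.d (-e • A.mul (A.b s) w₁) := by
  subst hxx hy hw
  rcases he with rfl | rfl <;>
  simp only [cupB, map_sub, map_add, map_smul, map_neg, LinearMap.add_apply,
    LinearMap.neg_apply, hs.b_mul, hbs.d_mul, hx.b_mul, hbx,
    A.b_b, A.d_b, map_zero, LinearMap.zero_apply] <;> module

end BiDifferential

namespace DoubleFormSheaf

variable {X : Type u} [TopologicalSpace X] (F : DoubleFormSheaf X) (W : WedgeData F)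
  {U V : Opens X}

/-- The total module of forms on `U`, in which the bidegree identifications `cast` disappear. -/
abbrev Tot (U : Opens X) : Type u := DirectSum (ℤ × ℤ) fun i => ↥(F.E i.1 i.2 U)

/-- The inclusion of the `(p,q)`-forms into the total module. -/
def ι (U : Opens X) (p q : ℤ) : F.E p q U →ₗ[ℂ] Tot F U :=
  DirectSum.lof ℂ (ℤ × ℤ) (fun i => ↥(F.E i.1 i.2 U)) (p, q)

theorem ι_injective (p q : ℤ) : Function.Injective (F.ι U p q) :=
  DirectSum.of_injective (β := fun i : ℤ × ℤ => ↥(F.E i.1 i.2 U)) (p, q)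

@[simp]
theorem ι_cast {p q p' q' : ℤ} (hp : p = p') (hq : q = q') (x : F.E p q U) :
    F.ι U p' q' (F.cast U hp hq x) = F.ι U p q x := by
  subst hp hq; rfl

theorem res_cast {p q p' q' : ℤ} (hp : p = p') (hq : q = q') (h : U ≤ V) (x : F.E p q V) :
    F.res p' q' h (F.cast V hp hq x) = F.cast U hp hq (F.res p q h x) := by
  subst hp hq; rfl

theorem Tot.induction {P : Tot F U → Prop} (x : Tot F U) (hι : ∀ p q y, P (F.ι U p q y))
    (hadd : ∀ x y, P x → P y → P (x + y)) : P x :=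
  DirectSum.induction_on x (by simpa using hι 0 0 0) (fun i y => hι i.1 i.2 y) hadd

/-- `∂` on the total module. -/
def totDel (U : Opens X) : Tot F U →ₗ[ℂ] Tot F U :=
  DirectSum.toModule ℂ _ _ fun i => (F.ι U (i.1 + 1) i.2).comp (F.del i.1 i.2 U)

/-- `∂̄` on the total module. -/
def totDbar (U : Opens X) : Tot F U →ₗ[ℂ] Tot F U :=
  DirectSum.toModule ℂ _ _ fun i => (F.ι U i.1 (i.2 + 1)).comp (F.dbar i.1 i.2 U)

theorem totDel_ι (p q : ℤ) (x : F.E p q U) :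
    F.totDel U (F.ι U p q x) = F.ι U (p + 1) q (F.del p q U x) :=
  DirectSum.toModule_lof ℂ (M := fun i : ℤ × ℤ => ↥(F.E i.1 i.2 U)) (p, q) x

theorem totDbar_ι (p q : ℤ) (x : F.E p q U) :
    F.totDbar U (F.ι U p q x) = F.ι U p (q + 1) (F.dbar p q U x) :=
  DirectSum.toModule_lof ℂ (M := fun i : ℤ × ℤ => ↥(F.E i.1 i.2 U)) (p, q) x

/-- The exterior product on the total module. -/
def totWedge (U : Opens X) : Tot F U →ₗ[ℂ] Tot F U →ₗ[ℂ] Tot F U :=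
  DirectSum.toModule ℂ _ _ fun i => LinearMap.flip <| DirectSum.toModule ℂ _ _ fun j =>
    ((W.wedge i.1 i.2 j.1 j.2 U).compr₂ (F.ι U (i.1 + j.1) (i.2 + j.2))).flip

theorem totWedge_ι (p q r s : ℤ) (x : F.E p q U) (y : F.E r s U) :
    F.totWedge W U (F.ι U p q x) (F.ι U r s y) = F.ι U (p + r) (q + s) (W.wedge p q r s U x y) := by
  unfold totWedge
  rw [ι, DirectSum.toModule_lof, LinearMap.flip_apply, ι, DirectSum.toModule_lof]
  rfl

/-- The total module of forms with its two differentials and the exterior product. -/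
def tot (U : Opens X) : BiDifferential (Tot F U) where
  d := F.totDel U
  b := F.totDbar U
  mul := F.totWedge W U
  d_d x := by
    induction x using Tot.induction with
    | hι p q y => simp [totDel_ι, F.del_del]
    | hadd x y hx hy => simp [hx, hy]
  b_b x := by
    induction x using Tot.induction with
    | hι p q y => simp [totDbar_ι, F.dbar_dbar]
    | hadd x y hx hy => simp [hx, hy]
  d_b x := by
    induction x using Tot.induction with
    | hι p q y =>
      rw [totDbar_ι, totDel_ι, totDel_ι, totDbar_ι, eq_neg_of_add_eq_zero_left (F.del_dbar p q U y),
        map_neg]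
    | hadd x y hx hy => simp [hx, hy, add_comm]

@[simp]
theorem ι_del (p q : ℤ) (x : F.E p q U) :
    F.ι U (p + 1) q (F.del p q U x) = (F.tot W U).d (F.ι U p q x) := (F.totDel_ι p q x).symm

@[simp]
theorem ι_dbar (p q : ℤ) (x : F.E p q U) :
    F.ι U p (q + 1) (F.dbar p q U x) = (F.tot W U).b (F.ι U p q x) := (F.totDbar_ι p q x).symm

@[simp]
theorem ι_wedge (p q r s : ℤ) (x : F.E p q U) (y : F.E r s U) :
    F.ι U (p + r) (q + s) (W.wedge p q r s U x y)
      = (F.tot W U).mul (F.ι U p q x) (F.ι U r s y) := (F.totWedge_ι W p q r s x y).symm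

theorem leibniz_ι (p q : ℤ) (x : F.E p q U) :
    (F.tot W U).Leibniz ((-1) ^ (p + q)) (F.ι U p q x) where
  d_mul y := by
    induction y using Tot.induction with
    | hι r s y =>
      rw [← ι_wedge, ← ι_del, W.wedge_del]
      simp [ι_del F W, ι_wedge F W]
    | hadd x y hx hy => simp only [map_add, hx, hy, smul_add]; abel
  b_mul y := by
    induction y using Tot.induction with
    | hι r s y =>
      rw [← ι_wedge, ← ι_dbar, W.wedge_dbar]
      simp [ι_dbar F W, ι_wedge F W]
    | hadd x y hx hy => simp only [map_add, hx, hy, smul_add]; abel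

theorem neg_one_zpow_eq (n : ℤ) : (-1 : ℂ) ^ n = 1 ∨ (-1 : ℂ) ^ n = -1 :=
  (Int.even_or_odd n).imp Even.neg_one_zpow Odd.neg_one_zpow

theorem leibniz_ι_even {p q n : ℤ} (h : Even (p + q - n)) (x : F.E p q U) :
    (F.tot W U).Leibniz ((-1) ^ n) (F.ι U p q x) := by
  have := F.leibniz_ι W p q x
  rwa [← sub_add_cancel (p + q) n, zpow_add₀ (by norm_num), h.neg_one_zpow, one_mul] at this

theorem leibniz_ι_odd {p q n : ℤ} (h : Odd (p + q - n)) (x : F.E p q U) :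
    (F.tot W U).Leibniz (-(-1) ^ n) (F.ι U p q x) := by
  have := F.leibniz_ι W p q x
  rwa [← sub_add_cancel (p + q) n, zpow_add₀ (by norm_num), h.neg_one_zpow, neg_one_mul] at this

section Cup

variable {U₀ U₁ : Opens X} {p q r s : ℤ}

/-- The cup product of a Čech–Bott–Chern and a Čech–Aeppli cochain. -/
noncomputable def cup (σ : TBC F U₀ U₁ p q) (ξ : TA F U₀ U₁ r s) :
    TA F U₀ U₁ (p + r) (q + s) :=
  (W.wedge p q r s U₀ σ.1 ξ.1,
   W.wedge p q r s U₁ σ.2.1 ξ.2.1,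
   (((-1 : ℂ) ^ (p + q)) •
        F.cast _ rfl (show q + (s - 1) = q + s - 1 by ring)
          (W.wedge p q r (s - 1) _ (F.res p q inf_le_left σ.1) ξ.2.2.1)
      + F.cast _ (show p - 1 + 1 + r = p + r by ring) (show q - 1 + s = q + s - 1 by ring)
          (W.wedge (p - 1 + 1) (q - 1) r s _ (F.del (p - 1) (q - 1) _ σ.2.2)
            (F.res r s inf_le_right ξ.2.1))
      - (2⁻¹ : ℂ) •
          F.cast _ (show p - 1 + r + 1 = p + r by ring) (show q - 1 + s = q + s - 1 by ring)
            (F.del (p - 1 + r) (q - 1 + s) _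
              (W.wedge (p - 1) (q - 1) r s _ σ.2.2 (F.res r s inf_le_right ξ.2.1))),
    ((-1 : ℂ) ^ (p + q)) •
        F.cast _ (show p + (r - 1) = p + r - 1 by ring) rfl
          (W.wedge p q (r - 1) s _ (F.res p q inf_le_left σ.1) ξ.2.2.2)
      - F.cast _ (show p - 1 + r = p + r - 1 by ring) (show q - 1 + 1 + s = q + s by ring)
          (W.wedge (p - 1) (q - 1 + 1) r s _ (F.dbar (p - 1) (q - 1) _ σ.2.2)
            (F.res r s inf_le_right ξ.2.1))
      + (2⁻¹ : ℂ) •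
          F.cast _ (show p - 1 + r = p + r - 1 by ring) (show q - 1 + s + 1 = q + s by ring)
            (F.dbar (p - 1 + r) (q - 1 + s) _
              (W.wedge (p - 1) (q - 1) r s _ σ.2.2 (F.res r s inf_le_right ξ.2.1)))))

theorem cup_sub_left (σ σ' : TBC F U₀ U₁ p q) (ξ : TA F U₀ U₁ r s) :
    F.cup W (σ - σ') ξ = F.cup W σ ξ - F.cup W σ' ξ := by
  refine Prod.ext ?_ (Prod.ext ?_ (Prod.ext ?_ ?_)) <;>
  simp only [cup, Prod.fst_sub, Prod.snd_sub, map_sub, LinearMap.sub_apply] <;> module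

theorem cup_sub_right (σ : TBC F U₀ U₁ p q) (ξ ξ' : TA F U₀ U₁ r s) :
    F.cup W σ (ξ - ξ') = F.cup W σ ξ - F.cup W σ ξ' := by
  refine Prod.ext ?_ (Prod.ext ?_ (Prod.ext ?_ ?_)) <;>
  simp only [cup, Prod.fst_sub, Prod.snd_sub, map_sub] <;> module

theorem ι_cup_fst (σ : TBC F U₀ U₁ p q) (ξ : TA F U₀ U₁ r s) :
    F.ι U₀ _ _ (F.cup W σ ξ).1 = (F.tot W U₀).mul (F.ι U₀ p q σ.1) (F.ι U₀ r s ξ.1) :=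
  F.ι_wedge W ..

theorem ι_cup_snd (σ : TBC F U₀ U₁ p q) (ξ : TA F U₀ U₁ r s) :
    F.ι U₁ _ _ (F.cup W σ ξ).2.1 = (F.tot W U₁).mul (F.ι U₁ p q σ.2.1) (F.ι U₁ r s ξ.2.1) :=
  F.ι_wedge W ..

theorem ι_cup_del (σ : TBC F U₀ U₁ p q) (ξ : TA F U₀ U₁ r s) :
    F.ι _ _ _ (F.cup W σ ξ).2.2.1 =
      (-1 : ℂ) ^ (p + q) • (F.tot W _).mul (F.ι _ p q (F.res p q inf_le_left σ.1))
          (F.ι _ r (s - 1) ξ.2.2.1)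
        + (F.tot W _).cupD (F.ι _ (p - 1) (q - 1) σ.2.2)
          (F.ι _ r s (F.res r s inf_le_right ξ.2.1)) := by
  simp [cup, BiDifferential.cupD, ι_wedge F W, ι_del F W, add_sub_assoc]

theorem ι_cup_dbar (σ : TBC F U₀ U₁ p q) (ξ : TA F U₀ U₁ r s) :
    F.ι _ _ _ (F.cup W σ ξ).2.2.2 =
      (-1 : ℂ) ^ (p + q) • (F.tot W _).mul (F.ι _ p q (F.res p q inf_le_left σ.1))
          (F.ι _ (r - 1) s ξ.2.2.2)
        + (F.tot W _).cupB (F.ι _ (p - 1) (q - 1) σ.2.2)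
          (F.ι _ r s (F.res r s inf_le_right ξ.2.1)) := by
  simp [cup, BiDifferential.cupB, ι_wedge F W, ι_dbar F W, add_assoc, sub_eq_add_neg]

theorem DtoTT_apply (σ : TBC F U₀ U₁ p q) :
    DtoTT F U₀ U₁ p q σ =
      ((F.del p q U₀ σ.1, F.dbar p q U₀ σ.1), (F.del p q U₁ σ.2.1, F.dbar p q U₁ σ.2.1),
        F.res p q inf_le_right σ.2.1 - F.res p q inf_le_left σ.1
          - F.cast _ (by ring) (by ring) (F.dbar _ _ _ (F.del _ _ _ σ.2.2))) := rfl

theorem DtoTBC_apply (ξ : TA F U₀ U₁ r s) :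
    DtoTBC F U₀ U₁ r s ξ =
      (F.dbar _ _ _ (F.del _ _ _ ξ.1), F.dbar _ _ _ (F.del _ _ _ ξ.2.1),
        F.cast _ (by ring) (by ring) (F.res r s inf_le_right ξ.2.1 - F.res r s inf_le_left ξ.1
          - F.cast _ rfl (by ring) (F.dbar _ _ _ ξ.2.2.1)
          - F.cast _ (by ring) rfl (F.del _ _ _ ξ.2.2.2))) := rfl

theorem DtoTA_apply (α : TT F U₀ U₁ p q) :
    DtoTA F U₀ U₁ p q α =
      (F.dbar _ _ _ α.1.1 + F.del _ _ _ α.1.2, F.dbar _ _ _ α.2.1.1 + F.del _ _ _ α.2.1.2,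
        F.cast _ rfl (by ring) (F.res _ _ inf_le_right α.2.1.1 - F.res _ _ inf_le_left α.1.1
          - F.del _ _ _ α.2.2),
        F.cast _ (by ring) rfl (F.res _ _ inf_le_right α.2.1.2 - F.res _ _ inf_le_left α.1.2
          - F.dbar _ _ _ α.2.2)) := rfl

theorem castTBC_apply {p' q' : ℤ} (hp : p = p') (hq : q = q') (σ : TBC F U₀ U₁ p q) :
    castTBC F U₀ U₁ hp hq σ = (F.cast _ hp hq σ.1, F.cast _ hp hq σ.2.1,
      F.cast _ (by rw [hp]) (by rw [hq]) σ.2.2) := rfl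

theorem castTA_apply {p' q' : ℤ} (hp : p = p') (hq : q = q') (ξ : TA F U₀ U₁ p q) :
    castTA F U₀ U₁ hp hq ξ = (F.cast _ hp hq ξ.1, F.cast _ hp hq ξ.2.1,
      F.cast _ hp (by rw [hq]) ξ.2.2.1, F.cast _ (by rw [hp]) hq ξ.2.2.2) := rfl

theorem DtoTT_eq_zero {σ : TBC F U₀ U₁ p q} (h : DtoTT F U₀ U₁ p q σ = 0) :
    (F.del p q U₀ σ.1 = 0 ∧ F.dbar p q U₀ σ.1 = 0) ∧
    (F.del p q U₁ σ.2.1 = 0 ∧ F.dbar p q U₁ σ.2.1 = 0) ∧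
    F.ι (U₀ ⊓ U₁) p q (F.res p q inf_le_right σ.2.1) = F.ι (U₀ ⊓ U₁) p q (F.res p q inf_le_left σ.1)
      + (F.tot W _).b ((F.tot W _).d (F.ι _ (p - 1) (q - 1) σ.2.2)) := by
  rw [DtoTT_apply] at h
  obtain ⟨h₀, h₁, h₂⟩ : _ ∧ _ ∧ _ := by
    simpa only [Prod.ext_iff, Prod.fst_zero, Prod.snd_zero] using h
  refine ⟨h₀, h₁, ?_⟩
  have := congrArg (F.ι (U₀ ⊓ U₁) p q) h₂
  simp only [map_sub, ι_cast, ι_del F W, ι_dbar F W, map_zero] at this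
  rw [← sub_eq_iff_eq_add', ← sub_eq_zero, this]

theorem DtoTBC_eq_zero_iff {ξ : TA F U₀ U₁ r s} :
    DtoTBC F U₀ U₁ r s ξ = 0 ↔
    (F.tot W _).b ((F.tot W _).d (F.ι _ r s ξ.1)) = 0 ∧
    (F.tot W _).b ((F.tot W _).d (F.ι _ r s ξ.2.1)) = 0 ∧
    F.ι (U₀ ⊓ U₁) r s (F.res r s inf_le_left ξ.1) = F.ι (U₀ ⊓ U₁) r s (F.res r s inf_le_right ξ.2.1)
      - (F.tot W _).b (F.ι _ r (s - 1) ξ.2.2.1) - (F.tot W _).d (F.ι _ (r - 1) s ξ.2.2.2) := by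
  rw [← ι_del, ← ι_dbar, map_eq_zero_iff _ (F.ι_injective _ _), ← ι_del, ← ι_dbar,
    map_eq_zero_iff _ (F.ι_injective _ _), Prod.ext_iff, Prod.ext_iff]
  refine and_congr Iff.rfl (and_congr Iff.rfl ?_)
  rw [← (F.ι_injective _ _).eq_iff]
  simp only [DtoTBC_apply, map_sub, ι_cast, ι_del F W, ι_dbar F W, Prod.snd_zero, map_zero]
  constructor <;> intro h
  · rw [← sub_eq_zero, ← neg_eq_zero, ← h]; abel
  · rw [h]; abel

theorem b_d_ι_res {h : U ≤ V} {x : F.E p q V}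
    (hx : (F.tot W V).b ((F.tot W V).d (F.ι V p q x)) = 0) :
    (F.tot W U).b ((F.tot W U).d (F.ι U p q (F.res p q h x))) = 0 := by
  rw [← ι_del, ← ι_dbar, map_eq_zero_iff _ (F.ι_injective _ _)] at hx ⊢
  rw [F.res_del, F.res_dbar, hx, map_zero]

theorem DtoTBC_cup {σ : TBC F U₀ U₁ p q} {ξ : TA F U₀ U₁ r s}
    (hσ : DtoTT F U₀ U₁ p q σ = 0) (hξ : DtoTBC F U₀ U₁ r s ξ = 0) :
    DtoTBC F U₀ U₁ (p + r) (q + s) (F.cup W σ ξ) = 0 := by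
  obtain ⟨⟨hd₀, hb₀⟩, ⟨hd₁, hb₁⟩, h₀₁⟩ := F.DtoTT_eq_zero W hσ
  obtain ⟨hξ₀, hξ₁, hξ₀₁⟩ := (F.DtoTBC_eq_zero_iff W).1 hξ
  rw [DtoTBC_eq_zero_iff F W, ι_cup_fst, ι_cup_snd, ι_cup_del, ι_cup_dbar]
  refine ⟨?_, ?_, ?_⟩
  · exact BiDifferential.b_d_mul_of_closed (F.leibniz_ι W p q _) (by rw [← ι_del, hd₀, map_zero])
      (by rw [← ι_dbar, hb₀, map_zero]) hξ₀
  · exact BiDifferential.b_d_mul_of_closed (F.leibniz_ι W p q _) (by rw [← ι_del, hd₁, map_zero])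
      (by rw [← ι_dbar, hb₁, map_zero]) hξ₁
  · have := BiDifferential.mul_sub_mul_eq (neg_one_zpow_eq (p + q))
      (F.leibniz_ι W p q (F.res p q inf_le_left σ.1))
      (by rw [← ι_del, F.res_del, hd₀, map_zero, map_zero])
      (by rw [← ι_dbar, F.res_dbar, hb₀, map_zero, map_zero])
      (F.leibniz_ι_even W (by grind) σ.2.2)
      (by rw [← ι_del]; exact F.leibniz_ι_odd W (by grind) _)
      (by rw [← ι_dbar]; exact F.leibniz_ι_odd W (by grind) _) h₀₁ hξ₀₁ (F.b_d_ι_res W hξ₁)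
    rw [sub_sub, ← this]
    simp only [cup, W.wedge_res, ι_wedge]
    abel

theorem mem_BBC {σ : TBC F U₀ U₁ p q}
    (h : σ ∈ Set.range ((castTBC F U₀ U₁ (show p - 1 + 1 = p by ring)
      (show q - 1 + 1 = q by ring)).comp (DtoTBC F U₀ U₁ (p - 1) (q - 1)))) :
    ∃ (τ₀ : F.E (p - 1) (q - 1) U₀) (τ₁ : F.E (p - 1) (q - 1) U₁)
      (t : F.E (p - 1) (q - 1 - 1) (U₀ ⊓ U₁)) (u : F.E (p - 1 - 1) (q - 1) (U₀ ⊓ U₁)),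
      F.ι _ p q σ.1 = (F.tot W _).b ((F.tot W _).d (F.ι _ _ _ τ₀)) ∧
      F.ι _ p q σ.2.1 = (F.tot W _).b ((F.tot W _).d (F.ι _ _ _ τ₁)) ∧
      F.ι (U₀ ⊓ U₁) p q (F.res p q inf_le_left σ.1)
        = (F.tot W _).b ((F.tot W _).d (F.ι (U₀ ⊓ U₁) _ _ (F.res _ _ inf_le_left τ₀))) ∧
      F.ι _ _ _ σ.2.2 = F.ι (U₀ ⊓ U₁) _ _ (F.res _ _ inf_le_right τ₁)
        - F.ι (U₀ ⊓ U₁) _ _ (F.res _ _ inf_le_left τ₀)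
        - (F.tot W _).b (F.ι _ _ _ t) - (F.tot W _).d (F.ι _ _ _ u) := by
  obtain ⟨⟨τ₀, τ₁, t, u⟩, rfl⟩ := h
  refine ⟨τ₀, τ₁, t, u, ?_, ?_, ?_, ?_⟩ <;>
  simp [castTBC_apply, DtoTBC_apply, ι_del F W, ι_dbar F W, res_cast,
    ← F.res_del, ← F.res_dbar]

theorem mem_BA {ξ : TA F U₀ U₁ r s}
    (h : ξ ∈ Set.range ((castTA F U₀ U₁ (show r - 1 + 1 = r by ring)
      (show s - 1 + 1 = s by ring)).comp (DtoTA F U₀ U₁ (r - 1) (s - 1)))) :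
    ∃ (v₀ : F.E r (s - 1) U₀) (w₀ : F.E (r - 1) s U₀)
      (v₁ : F.E r (s - 1) U₁) (w₁ : F.E (r - 1) s U₁) (z : F.E (r - 1) (s - 1) (U₀ ⊓ U₁)),
      F.ι _ r s ξ.1 = (F.tot W _).b (F.ι _ _ _ v₀) + (F.tot W _).d (F.ι _ _ _ w₀) ∧
      F.ι _ r s ξ.2.1 = (F.tot W _).b (F.ι _ _ _ v₁) + (F.tot W _).d (F.ι _ _ _ w₁) ∧
      F.ι (U₀ ⊓ U₁) r s (F.res r s inf_le_right ξ.2.1)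
        = (F.tot W _).b (F.ι (U₀ ⊓ U₁) _ _ (F.res _ _ inf_le_right v₁))
          + (F.tot W _).d (F.ι (U₀ ⊓ U₁) _ _ (F.res _ _ inf_le_right w₁)) ∧
      F.ι _ _ _ ξ.2.2.1 = F.ι (U₀ ⊓ U₁) _ _ (F.res _ _ inf_le_right v₁)
        - F.ι (U₀ ⊓ U₁) _ _ (F.res _ _ inf_le_left v₀) - (F.tot W _).d (F.ι _ _ _ z) ∧
      F.ι _ _ _ ξ.2.2.2 = F.ι (U₀ ⊓ U₁) _ _ (F.res _ _ inf_le_right w₁)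
        - F.ι (U₀ ⊓ U₁) _ _ (F.res _ _ inf_le_left w₀) - (F.tot W _).b (F.ι _ _ _ z) := by
  obtain ⟨⟨⟨v₀, w₀⟩, ⟨v₁, w₁⟩, z⟩, rfl⟩ := h
  refine ⟨F.cast _ (by ring) rfl v₀, F.cast _ rfl (by ring) w₀, F.cast _ (by ring) rfl v₁,
    F.cast _ rfl (by ring) w₁, z, ?_, ?_, ?_, ?_, ?_⟩ <;>
  simp [castTA_apply, DtoTA_apply, ι_del F W, ι_dbar F W, res_cast,
    ← F.res_del, ← F.res_dbar]

/-- By softness, a Čech–Aeppli cochain is a coboundary as soon as it is one up to `∂̄g` and `∂k`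
on the overlap. -/
theorem mem_BA_of_eq (hcov : U₀ ⊔ U₁ = ⊤) {ξ : TA F U₀ U₁ r s}
    (v₀ : F.E r (s - 1) U₀) (w₀ : F.E (r - 1) s U₀)
    (v₁ : F.E r (s - 1) U₁) (w₁ : F.E (r - 1) s U₁) (z : F.E (r - 1) (s - 1) (U₀ ⊓ U₁))
    (g : F.E r (s - 1 - 1) (U₀ ⊓ U₁)) (k : F.E (r - 1 - 1) s (U₀ ⊓ U₁))
    (h₀ : F.ι _ r s ξ.1 = (F.tot W _).b (F.ι _ _ _ v₀) + (F.tot W _).d (F.ι _ _ _ w₀))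
    (h₁ : F.ι _ r s ξ.2.1 = (F.tot W _).b (F.ι _ _ _ v₁) + (F.tot W _).d (F.ι _ _ _ w₁))
    (hv : F.ι _ _ _ ξ.2.2.1 = F.ι (U₀ ⊓ U₁) _ _ (F.res _ _ inf_le_right v₁)
        - F.ι (U₀ ⊓ U₁) _ _ (F.res _ _ inf_le_left v₀) - (F.tot W _).d (F.ι _ _ _ z)
        - (F.tot W _).b (F.ι _ _ _ g))
    (hw : F.ι _ _ _ ξ.2.2.2 = F.ι (U₀ ⊓ U₁) _ _ (F.res _ _ inf_le_right w₁)
        - F.ι (U₀ ⊓ U₁) _ _ (F.res _ _ inf_le_left w₀) - (F.tot W _).b (F.ι _ _ _ z)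
        - (F.tot W _).d (F.ι _ _ _ k)) :
    ξ ∈ Set.range ((castTA F U₀ U₁ (show r - 1 + 1 = r by ring)
      (show s - 1 + 1 = s by ring)).comp (DtoTA F U₀ U₁ (r - 1) (s - 1))) := by
  obtain ⟨z₀, z₁, hz⟩ := F.pou hcov
  have hg := congrArg (F.ι (U₀ ⊓ U₁) _ _) (hz _ _ g)
  have hk := congrArg (F.ι (U₀ ⊓ U₁) _ _) (hz _ _ k)
  rw [map_add] at hg hk
  refine ⟨((F.cast _ (by ring) rfl (v₀ + F.cast _ rfl (by ring) (F.dbar _ _ _ (z₀ _ _ g))),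
      F.cast _ rfl (by ring) (w₀ + F.cast _ (by ring) rfl (F.del _ _ _ (z₀ _ _ k)))),
    (F.cast _ (by ring) rfl (v₁ - F.cast _ rfl (by ring) (F.dbar _ _ _ (z₁ _ _ g))),
      F.cast _ rfl (by ring) (w₁ - F.cast _ (by ring) rfl (F.del _ _ _ (z₁ _ _ k)))), z), ?_⟩
  refine Prod.ext ?_ (Prod.ext ?_ (Prod.ext ?_ ?_)) <;> apply F.ι_injective
  · simp [castTA_apply, DtoTA_apply, ι_del F W, ι_dbar F W, h₀,
      BiDifferential.d_d, BiDifferential.b_b]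
  · simp [castTA_apply, DtoTA_apply, ι_del F W, ι_dbar F W, h₁,
      BiDifferential.d_d, BiDifferential.b_b]
  · rw [hv, ← hg]
    simp [castTA_apply, DtoTA_apply, ι_del F W, ι_dbar F W, res_cast,
      ← F.res_dbar]
    abel
  · rw [hw, ← hk]
    simp [castTA_apply, DtoTA_apply, ι_del F W, ι_dbar F W, res_cast,
      ← F.res_del]
    abel

theorem cup_mem_BA_of_left (hcov : U₀ ⊔ U₁ = ⊤) {σ : TBC F U₀ U₁ p q} {ξ : TA F U₀ U₁ r s}
    (hσ : σ ∈ Set.range ((castTBC F U₀ U₁ (show p - 1 + 1 = p by ring)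
      (show q - 1 + 1 = q by ring)).comp (DtoTBC F U₀ U₁ (p - 1) (q - 1))))
    (hξ : DtoTBC F U₀ U₁ r s ξ = 0) :
    F.cup W σ ξ ∈ Set.range ((castTA F U₀ U₁ (show p + r - 1 + 1 = p + r by ring)
      (show q + s - 1 + 1 = q + s by ring)).comp (DtoTA F U₀ U₁ (p + r - 1) (q + s - 1))) := by
  obtain ⟨τ₀, τ₁, t, u, hσ₀, hσ₁, hσ₀', hσ₀₁⟩ := F.mem_BBC W hσ
  obtain ⟨hξ₀, hξ₁, hξ₀₁⟩ := (F.DtoTBC_eq_zero_iff W).1 hξ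
  have he := neg_one_zpow_eq (p + q)
  refine F.mem_BA_of_eq W hcov
    (F.cast _ (by ring) (by ring) (W.wedge _ _ _ _ _ (F.del _ _ _ τ₀) ξ.1)
      - (2⁻¹ : ℂ) • F.cast _ (by ring) (by ring) (F.del _ _ _ (W.wedge _ _ _ _ _ τ₀ ξ.1)))
    (-F.cast _ (by ring) (by ring) (W.wedge _ _ _ _ _ (F.dbar _ _ _ τ₀) ξ.1)
      + (2⁻¹ : ℂ) • F.cast _ (by ring) (by ring) (F.dbar _ _ _ (W.wedge _ _ _ _ _ τ₀ ξ.1)))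
    (F.cast _ (by ring) (by ring) (W.wedge _ _ _ _ _ (F.del _ _ _ τ₁) ξ.2.1)
      - (2⁻¹ : ℂ) • F.cast _ (by ring) (by ring) (F.del _ _ _ (W.wedge _ _ _ _ _ τ₁ ξ.2.1)))
    (-F.cast _ (by ring) (by ring) (W.wedge _ _ _ _ _ (F.dbar _ _ _ τ₁) ξ.2.1)
      + (2⁻¹ : ℂ) • F.cast _ (by ring) (by ring) (F.dbar _ _ _ (W.wedge _ _ _ _ _ τ₁ ξ.2.1)))
    ((2⁻¹ : ℂ) •
      (F.cast _ (by ring) (by ring) (W.wedge _ _ _ _ _ (F.res _ _ inf_le_left τ₀)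
          (F.del _ _ _ ξ.2.2.2))
        - F.cast _ (by ring) (by ring) (W.wedge _ _ _ _ _ (F.res _ _ inf_le_left τ₀)
          (F.dbar _ _ _ ξ.2.2.1))
        + F.cast _ (by ring) (by ring) (W.wedge _ _ _ _ _ (F.dbar _ _ _ t)
          (F.res r s inf_le_right ξ.2.1))
        - F.cast _ (by ring) (by ring) (W.wedge _ _ _ _ _ (F.del _ _ _ u)
          (F.res r s inf_le_right ξ.2.1))))
    (-(-1 : ℂ) ^ (p + q) •
      (F.cast _ (by ring) (by ring) (W.wedge _ _ _ _ _ (F.del _ _ _ (F.res _ _ inf_le_left τ₀))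
          ξ.2.2.1)
        + F.cast _ (by ring) (by ring) (W.wedge _ _ _ _ _ t
          (F.del _ _ _ (F.res r s inf_le_right ξ.2.1)))))
    ((-1 : ℂ) ^ (p + q) •
      (F.cast _ (by ring) (by ring) (W.wedge _ _ _ _ _ (F.dbar _ _ _ (F.res _ _ inf_le_left τ₀))
          ξ.2.2.2)
        + F.cast _ (by ring) (by ring) (W.wedge _ _ _ _ _ u
          (F.dbar _ _ _ (F.res r s inf_le_right ξ.2.1))))) ?_ ?_ ?_ ?_
  · rw [ι_cup_fst, hσ₀, ← BiDifferential.b_cupD_add_d_cupB he (F.leibniz_ι_even W (by grind) τ₀)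
      (by rw [← ι_del]; exact F.leibniz_ι_odd W (by grind) _)
      (by rw [← ι_dbar]; exact F.leibniz_ι_odd W (by grind) _) hξ₀]
    simp [BiDifferential.cupD, BiDifferential.cupB, ι_del F W, ι_dbar F W, ι_wedge F W]
  · rw [ι_cup_snd, hσ₁, ← BiDifferential.b_cupD_add_d_cupB he (F.leibniz_ι_even W (by grind) τ₁)
      (by rw [← ι_del]; exact F.leibniz_ι_odd W (by grind) _)
      (by rw [← ι_dbar]; exact F.leibniz_ι_odd W (by grind) _) hξ₁]
    simp [BiDifferential.cupD, BiDifferential.cupB, ι_del F W, ι_dbar F W, ι_wedge F W]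
  · rw [ι_cup_del, BiDifferential.cupD_coboundary_left he hσ₀' hσ₀₁ hξ₀₁ (F.b_d_ι_res W hξ₁)
      (F.leibniz_ι_even W (by grind) _)
      (by rw [← ι_del]; exact F.leibniz_ι_odd W (by grind) _)
      (F.leibniz_ι_odd W (by grind) _)
      (by rw [← ι_dbar]; exact F.leibniz_ι_even W (by grind) _)
      (by rw [← ι_del]; exact F.leibniz_ι_even W (by grind) _)]
    simp [BiDifferential.cupD, ι_del F W, ι_dbar F W, ι_wedge F W, res_cast, W.wedge_res,
      ← F.res_del]
  · rw [ι_cup_dbar, BiDifferential.cupB_coboundary_left he hσ₀' hσ₀₁ hξ₀₁ (F.b_d_ι_res W hξ₁)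
      (F.leibniz_ι_even W (by grind) _)
      (by rw [← ι_dbar]; exact F.leibniz_ι_odd W (by grind) _)
      (F.leibniz_ι_odd W (by grind) _)
      (by rw [← ι_dbar]; exact F.leibniz_ι_even W (by grind) _)
      (by rw [← ι_del]; exact F.leibniz_ι_even W (by grind) _)]
    simp [BiDifferential.cupB, ι_del F W, ι_dbar F W, ι_wedge F W, res_cast, W.wedge_res,
      ← F.res_dbar]

theorem cup_mem_BA_of_right (hcov : U₀ ⊔ U₁ = ⊤) {σ : TBC F U₀ U₁ p q} {ξ : TA F U₀ U₁ r s}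
    (hσ : DtoTT F U₀ U₁ p q σ = 0)
    (hξ : ξ ∈ Set.range ((castTA F U₀ U₁ (show r - 1 + 1 = r by ring)
      (show s - 1 + 1 = s by ring)).comp (DtoTA F U₀ U₁ (r - 1) (s - 1)))) :
    F.cup W σ ξ ∈ Set.range ((castTA F U₀ U₁ (show p + r - 1 + 1 = p + r by ring)
      (show q + s - 1 + 1 = q + s by ring)).comp (DtoTA F U₀ U₁ (p + r - 1) (q + s - 1))) := by
  obtain ⟨⟨hd₀, hb₀⟩, ⟨hd₁, hb₁⟩, h₀₁⟩ := F.DtoTT_eq_zero W hσ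
  obtain ⟨v₀, w₀, v₁, w₁, z, hξ₀, hξ₁, hξ₁', hv, hw⟩ := F.mem_BA W hξ
  have he := neg_one_zpow_eq (p + q)
  have hs := F.leibniz_ι_even W (n := p + q) (by grind) σ.2.2
  have hσ₀ := F.leibniz_ι W p q (F.res p q (inf_le_left : U₀ ⊓ U₁ ≤ U₀) σ.1)
  refine F.mem_BA_of_eq W hcov
    ((-1 : ℂ) ^ (p + q) • F.cast _ (by ring) (by ring) (W.wedge _ _ _ _ _ σ.1 v₀))
    ((-1 : ℂ) ^ (p + q) • F.cast _ (by ring) (by ring) (W.wedge _ _ _ _ _ σ.1 w₀))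
    ((-1 : ℂ) ^ (p + q) • F.cast _ (by ring) (by ring) (W.wedge _ _ _ _ _ σ.2.1 v₁))
    ((-1 : ℂ) ^ (p + q) • F.cast _ (by ring) (by ring) (W.wedge _ _ _ _ _ σ.2.1 w₁))
    ((2⁻¹ : ℂ) •
      (F.cast _ (by ring) (by ring) (W.wedge _ _ _ _ _ σ.2.2
          (F.dbar _ _ _ (F.res _ _ inf_le_right v₁)))
        - F.cast _ (by ring) (by ring) (W.wedge _ _ _ _ _ σ.2.2
          (F.del _ _ _ (F.res _ _ inf_le_right w₁))))
      + F.cast _ (by ring) (by ring) (W.wedge _ _ _ _ _ (F.res p q inf_le_left σ.1) z))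
    ((-1 : ℂ) ^ (p + q) • F.cast _ (by ring) (by ring)
      (W.wedge _ _ _ _ _ (F.del _ _ _ σ.2.2) (F.res _ _ inf_le_right v₁)))
    (-(-1 : ℂ) ^ (p + q) • F.cast _ (by ring) (by ring)
      (W.wedge _ _ _ _ _ (F.dbar _ _ _ σ.2.2) (F.res _ _ inf_le_right w₁))) ?_ ?_ ?_ ?_
  · rw [ι_cup_fst, hξ₀]
    simp only [map_smul, ι_cast, ι_wedge F W]
    exact BiDifferential.mul_coboundary_of_closed he (F.leibniz_ι W p q _)
      (by rw [← ι_del, hd₀, map_zero]) (by rw [← ι_dbar, hb₀, map_zero])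
  · rw [ι_cup_snd, hξ₁]
    simp only [map_smul, ι_cast, ι_wedge F W]
    exact BiDifferential.mul_coboundary_of_closed he (F.leibniz_ι W p q _)
      (by rw [← ι_del, hd₁, map_zero]) (by rw [← ι_dbar, hb₁, map_zero])
  · rw [ι_cup_del, BiDifferential.cupD_coboundary_right he hσ₀
      (by rw [← ι_del, F.res_del, hd₀, map_zero, map_zero]) hs
      (by rw [← ι_del]; exact F.leibniz_ι_odd W (by grind) _) h₀₁ hξ₁' hv]
    simp [ι_del F W, ι_dbar F W, ι_wedge F W, res_cast, W.wedge_res]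
  · rw [ι_cup_dbar, BiDifferential.cupB_coboundary_right he hσ₀
      (by rw [← ι_dbar, F.res_dbar, hb₀, map_zero, map_zero]) hs
      (by rw [← ι_dbar]; exact F.leibniz_ι_odd W (by grind) _) h₀₁ hξ₁' hw]
    simp [ι_del F W, ι_dbar F W, ι_wedge F W, res_cast, W.wedge_res]

theorem cup_tBC_tA (ω : F.E p q ⊤) (θ : F.E r s ⊤) :
    F.cup W (tBC F U₀ U₁ p q ω) (tA F U₀ U₁ r s θ)
      = tA F U₀ U₁ (p + r) (q + s) (W.wedge p q r s ⊤ ω θ) := by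
  simp [cup, tBC, tA, lmTri, W.wedge_res]

end Cup

end DoubleFormSheaf

set_option maxHeartbeats 2000000 in
/-- Proposition 4.2 of the paper. -/
theorem statement11 {X : Type u} [TopologicalSpace X] (F : DoubleFormSheaf X)
    (W : WedgeData F) (U₀ U₁ : Opens X) (hcov : U₀ ⊔ U₁ = ⊤) (p q r s : ℤ) :
    letI BBC : Set (TBC F U₀ U₁ p q) :=
      Set.range
        ((castTBC F U₀ U₁ (show p - 1 + 1 = p by ring) (show q - 1 + 1 = q by ring)).comp
          (DtoTBC F U₀ U₁ (p - 1) (q - 1)))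
    letI BArs : Set (TA F U₀ U₁ r s) :=
      Set.range
        ((castTA F U₀ U₁ (show r - 1 + 1 = r by ring) (show s - 1 + 1 = s by ring)).comp
          (DtoTA F U₀ U₁ (r - 1) (s - 1)))
    letI BAtot : Set (TA F U₀ U₁ (p + r) (q + s)) :=
      Set.range
        ((castTA F U₀ U₁ (show p + r - 1 + 1 = p + r by ring)
            (show q + s - 1 + 1 = q + s by ring)).comp
          (DtoTA F U₀ U₁ (p + r - 1) (q + s - 1)))
    letI cup : TBC F U₀ U₁ p q → TA F U₀ U₁ r s → TA F U₀ U₁ (p + r) (q + s) := fun σ ξ =>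
      (W.wedge p q r s U₀ σ.1 ξ.1,
       W.wedge p q r s U₁ σ.2.1 ξ.2.1,
       (((-1 : ℂ) ^ (p + q)) •
            F.cast _ rfl (show q + (s - 1) = q + s - 1 by ring)
              (W.wedge p q r (s - 1) _ (F.res p q inf_le_left σ.1) ξ.2.2.1)
          + F.cast _ (show p - 1 + 1 + r = p + r by ring) (show q - 1 + s = q + s - 1 by ring)
              (W.wedge (p - 1 + 1) (q - 1) r s _ (F.del (p - 1) (q - 1) _ σ.2.2)
                (F.res r s inf_le_right ξ.2.1))
          - (2⁻¹ : ℂ) •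
              F.cast _ (show p - 1 + r + 1 = p + r by ring) (show q - 1 + s = q + s - 1 by ring)
                (F.del (p - 1 + r) (q - 1 + s) _
                  (W.wedge (p - 1) (q - 1) r s _ σ.2.2 (F.res r s inf_le_right ξ.2.1))),
        ((-1 : ℂ) ^ (p + q)) •
            F.cast _ (show p + (r - 1) = p + r - 1 by ring) rfl
              (W.wedge p q (r - 1) s _ (F.res p q inf_le_left σ.1) ξ.2.2.2)
          - F.cast _ (show p - 1 + r = p + r - 1 by ring) (show q - 1 + 1 + s = q + s by ring)
              (W.wedge (p - 1) (q - 1 + 1) r s _ (F.dbar (p - 1) (q - 1) _ σ.2.2)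
                (F.res r s inf_le_right ξ.2.1))
          + (2⁻¹ : ℂ) •
              F.cast _ (show p - 1 + r = p + r - 1 by ring) (show q - 1 + s + 1 = q + s by ring)
                (F.dbar (p - 1 + r) (q - 1 + s) _
                  (W.wedge (p - 1) (q - 1) r s _ σ.2.2 (F.res r s inf_le_right ξ.2.1)))))
    -- (1) cocycle ⌣ cocycle is a cocycle
    (∀ (σ : TBC F U₀ U₁ p q) (ξ : TA F U₀ U₁ r s),
      DtoTT F U₀ U₁ p q σ = 0 → DtoTBC F U₀ U₁ r s ξ = 0 →
        DtoTBC F U₀ U₁ (p + r) (q + s) (cup σ ξ) = 0) ∧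
    -- (2) coboundary ⌣ cocycle is a coboundary
    (∀ (σ : TBC F U₀ U₁ p q) (ξ : TA F U₀ U₁ r s),
      σ ∈ BBC → DtoTBC F U₀ U₁ r s ξ = 0 → cup σ ξ ∈ BAtot) ∧
    -- (3) cocycle ⌣ coboundary is a coboundary
    (∀ (σ : TBC F U₀ U₁ p q) (ξ : TA F U₀ U₁ r s),
      DtoTT F U₀ U₁ p q σ = 0 → ξ ∈ BArs → cup σ ξ ∈ BAtot) ∧
    -- hence the cup product induces a bilinear map on cohomology:
    (∀ (σ σ' : TBC F U₀ U₁ p q) (ξ ξ' : TA F U₀ U₁ r s),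
      DtoTT F U₀ U₁ p q σ = 0 → DtoTT F U₀ U₁ p q σ' = 0 →
      DtoTBC F U₀ U₁ r s ξ = 0 → DtoTBC F U₀ U₁ r s ξ' = 0 →
      σ - σ' ∈ BBC → ξ - ξ' ∈ BArs → cup σ ξ - cup σ' ξ' ∈ BAtot) ∧
    -- compatibility with the wedge-product pairing on global cohomology, via the canonical
    -- isomorphisms induced by `ω ↦ (ω, ω, 0)` and `θ ↦ (θ, θ, 0, 0)`:
    (∀ (ω : ↥(F.E p q ⊤)) (θ : ↥(F.E r s ⊤)),
      cup (tBC F U₀ U₁ p q ω) (tA F U₀ U₁ r s θ)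
        = tA F U₀ U₁ (p + r) (q + s) (W.wedge p q r s ⊤ ω θ)) := by
  refine ⟨fun _ _ => F.DtoTBC_cup W, fun _ _ => F.cup_mem_BA_of_left W hcov,
    fun _ _ => F.cup_mem_BA_of_right W hcov, fun σ σ' ξ ξ' hσ hσ' hξ hξ' hσσ' hξξ' => ?_,
    F.cup_tBC_tA W⟩
  have h := Submodule.add_mem (LinearMap.range _)
    (LinearMap.mem_range.2 (F.cup_mem_BA_of_left W hcov hσσ' hξ))
    (LinearMap.mem_range.2 (F.cup_mem_BA_of_right W hcov hσ' hξξ'))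
  rw [cup_sub_left, cup_sub_right, sub_add_sub_cancel] at h
  exact h
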